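/- (Theorem: interactive lossless source coding.) In the setting where every node must reconstruct both other sources losslessly (constraints Pr(X̂_{ij}^n ≠ X_j^n) ≤ ε for all i ≠ j), a rate triple (R1,R2,R3) is achievable if and only if R1 ≥ H(X1|X2,X3), R2 ≥ H(X2|X1,X3), R3 ≥ H(X3|X1,X2), R1+R2 ≥ H(X1,X2|X3), R1+R3 ≥ H(X1,X3|X2), and R2+R3 ≥ H(X2,X3|X1); in particular, multiple rounds of interaction cannot enlarge the Slepian–Wolf-type rate region. -/

import Mathlib

noncomputable section

namespace IT

variable {Ω : Type*} [Fintype Ω]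

open Classical in
/-- Probability of an event under a weight function on a finite sample space. -/
def pr (w : Ω → ℝ) (E : Ω → Prop) : ℝ := ∑ ω, if E ω then w ω else 0

open Classical in
/-- The distribution (pmf) of a random variable. -/
def dist (w : Ω → ℝ) {α : Type*} [Fintype α] (X : Ω → α) (a : α) : ℝ :=
  ∑ ω, if X ω = a then w ω else 0

/-- Shannon entropy (base 2). -/
def H (w : Ω → ℝ) {α : Type*} [Fintype α] (X : Ω → α) : ℝ :=
  -∑ a, dist w X a * Real.logb 2 (dist w X a)

/-- Conditional entropy H(X|Y). -/
def condH (w : Ω → ℝ) {α β : Type*} [Fintype α] [Fintype β] (X : Ω → α) (Y : Ω → β) : ℝ :=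
  H w (fun ω => (X ω, Y ω)) - H w Y

/-- Mutual information I(X;Y). -/
def mutInfo (w : Ω → ℝ) {α β : Type*} [Fintype α] [Fintype β] (X : Ω → α) (Y : Ω → β) : ℝ :=
  H w X + H w Y - H w (fun ω => (X ω, Y ω))

/-- Conditional mutual information I(X;Y|Z). -/
def condMutInfo (w : Ω → ℝ) {α β γ : Type*} [Fintype α] [Fintype β] [Fintype γ]
    (X : Ω → α) (Y : Ω → β) (Z : Ω → γ) : ℝ :=
  condH w X Z - condH w X (fun ω => (Y ω, Z ω))

/-- Expectation of a real random variable. -/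
def expect (w : Ω → ℝ) (f : Ω → ℝ) : ℝ := ∑ ω, w ω * f ω

end IT

/-- `p` is a probability mass function on a finite type. -/
def IsPMF {α : Type*} [Fintype α] (p : α → ℝ) : Prop := (∀ a, 0 ≤ p a) ∧ ∑ a, p a = 1

/-- The i.i.d. (product) weight on `n`-sequences induced by a single-letter pmf. -/
def iidW {α : Type*} (p : α → ℝ) (n : ℕ) : (Fin n → α) → ℝ := fun x => ∏ t, p (x t)

/-- The first `l` components of a dependent tuple (the rest masked). -/
def trunc {K : ℕ} {γ : Fin K → Type*} (l : ℕ) (f : (k : Fin K) → γ k) :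
    (k : Fin K) → Option (γ k) :=
  fun k => if k.val < l then some (f k) else none

/-- Coordinates with (0-based) index `< t`. -/
def below {n : ℕ} {α : Type*} (t : ℕ) (x : Fin n → α) : Fin n → Option α :=
  fun s => if s.val < t then some (x s) else none

/-- Coordinates with (0-based) index `> t`. -/
def above {n : ℕ} {α : Type*} (t : ℕ) (x : Fin n → α) : Fin n → Option α :=
  fun s => if t < s.val then some (x s) else none

/-- Coordinates with (0-based) index `≥ t`. -/
def fromIdx {n : ℕ} {α : Type*} (t : ℕ) (x : Fin n → α) : Fin n → Option α :=
  fun s => if t ≤ s.val then some (x s) else none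

open Classical in
/-- Number of occurrences of `a` in the sequence `x`. -/
def Nocc {n : ℕ} {α : Type*} (a : α) (x : Fin n → α) : ℕ :=
  (Finset.univ.filter fun t => x t = a).card

/-- Strongly typical set. -/
def typical {α : Type*} [Fintype α] (Q : α → ℝ) (δ : ℝ) (n : ℕ) : Set (Fin n → α) :=
  {x | ∀ a, Q a ≠ 0 → |(Nocc a x : ℝ) / n - Q a| ≤ δ / Fintype.card α}


open IT

namespace SW
open Classical Finset

variable {A B : Type} [Fintype A] [Fintype B]

/-- information density -/
def dens (p : A → ℝ) (Y : A → B) (a : A) : ℝ :=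
  Real.logb 2 (dist p Y (Y a)) - Real.logb 2 (p a)

lemma sum_dist_mul (p : A → ℝ) (Y : A → B) (g : B → ℝ) :
    ∑ b, dist p Y b * g b = ∑ a, p a * g (Y a) := by
  unfold IT.dist
  simp_rw [Finset.sum_mul]
  rw [Finset.sum_comm]
  refine Finset.sum_congr rfl fun a _ => ?_
  simp [ite_mul]

lemma H_eq (p : A → ℝ) (Y : A → B) :
    H p Y = -∑ a, p a * Real.logb 2 (dist p Y (Y a)) := by
  unfold IT.H
  rw [sum_dist_mul p Y (fun b => Real.logb 2 (dist p Y b))]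

lemma dist_inj (p : A → ℝ) (Z : A → B) (hZ : Function.Injective Z) (a : A) :
    dist p Z (Z a) = p a := by
  unfold IT.dist
  simp [hZ.eq_iff]

lemma condH_eq {C : Type} [Fintype C] (p : A → ℝ) (X : A → C) (Y : A → B)
    (h : Function.Injective fun a => (X a, Y a)) :
    condH p X Y = ∑ a, p a * dens p Y a := by
  unfold IT.condH dens
  rw [H_eq, H_eq]
  have : ∀ a, dist p (fun ω => (X ω, Y ω)) (X a, Y a) = p a := fun a => dist_inj p _ h a
  simp_rw [this, mul_sub, Finset.sum_sub_distrib]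
  ring

lemma dist_ge (p : A → ℝ) (hp : IsPMF p) (Y : A → B) (a : A) : p a ≤ dist p Y (Y a) := by
  unfold IT.dist
  have := Finset.single_le_sum (f := fun ω => if Y ω = Y a then p ω else 0)
    (fun i _ => by split_ifs; exacts [hp.1 i, le_rfl]) (Finset.mem_univ a)
  simpa using this

lemma dist_nonneg (p : A → ℝ) (hp : IsPMF p) (Y : A → B) (b : B) : 0 ≤ dist p Y b := by
  unfold IT.dist
  exact Finset.sum_nonneg fun i _ => by split_ifs; exacts [hp.1 i, le_rfl]

lemma dist_sum (p : A → ℝ) (hp : IsPMF p) (Y : A → B) : ∑ b, dist p Y b = 1 := by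
  have := sum_dist_mul p Y (fun _ => 1)
  simpa [hp.2] using this

lemma dist_le_one (p : A → ℝ) (hp : IsPMF p) (Y : A → B) (b : B) : dist p Y b ≤ 1 := by
  rw [← dist_sum p hp Y]
  exact Finset.single_le_sum (fun i _ => dist_nonneg p hp Y i) (Finset.mem_univ b)

lemma dens_sum_nonneg (p : A → ℝ) (hp : IsPMF p) (Y : A → B) :
    0 ≤ ∑ a, p a * dens p Y a := by
  refine Finset.sum_nonneg fun a _ => ?_
  rcases (hp.1 a).eq_or_lt with h | h
  · simp [← h]
  · refine mul_nonneg h.le (sub_nonneg.2 ?_)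
    exact Real.logb_le_logb_of_le one_lt_two h (dist_ge p hp Y a)

lemma sum_prod (n : ℕ) (g : Fin n → A → ℝ) :
    ∑ x : Fin n → A, ∏ t, g t (x t) = ∏ t, ∑ a, g t a := by
  rw [Finset.prod_univ_sum, Fintype.piFinset_univ]

lemma iid_sum (p : A → ℝ) (hp : ∑ a, p a = 1) (n : ℕ) : ∑ x, iidW p n x = 1 := by
  unfold iidW
  rw [sum_prod n (fun _ => p)]; simp [hp]

lemma iid_nonneg (p : A → ℝ) (hp : ∀ a, 0 ≤ p a) (n : ℕ) (x) : 0 ≤ iidW p n x :=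
  Finset.prod_nonneg fun t _ => hp _

lemma iid_pmf (p : A → ℝ) (hp : IsPMF p) (n : ℕ) : IsPMF (iidW p n) :=
  ⟨iid_nonneg p hp.1 n, iid_sum p hp.2 n⟩

lemma iid_expect (p : A → ℝ) (hp : IsPMF p) (n : ℕ) (f : A → ℝ) :
    ∑ x, iidW p n x * ∑ t, f (x t) = n * ∑ a, p a * f a := by
  simp_rw [Finset.mul_sum (s := (univ : Finset (Fin n)))]
  rw [Finset.sum_comm]
  have : ∀ t : Fin n, ∑ x, iidW p n x * f (x t) = ∑ a, p a * f a := by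
    intro t
    have h := sum_prod n (fun s a => p a * if s = t then f a else 1)
    have h1 : ∀ x : Fin n → A, (∏ s, (p (x s) * if s = t then f (x s) else 1))
        = iidW p n x * f (x t) := by
      intro x
      rw [Finset.prod_mul_distrib]
      simp [iidW]
    rw [← Finset.sum_congr rfl (fun x _ => h1 x), h, Finset.prod_eq_single t]
    · simp
    · intro s _ hs; simp [hs, hp.2]
    · simp
  simp [this]

/-- log identity on support -/
lemma dens_iid (p : A → ℝ) (hp : IsPMF p) (Y : A → B) (n : ℕ) (x : Fin n → A)
    (hx : ∀ t, 0 < p (x t)) :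
    ∑ t, dens p Y (x t)
      = Real.logb 2 (∏ t, dist p Y (Y (x t))) - Real.logb 2 (iidW p n x) := by
  unfold dens iidW
  rw [Finset.sum_sub_distrib, Real.logb_prod, Real.logb_prod]
  · intro t _; exact (hx t).ne'
  · intro t _; exact ((hx t).trans_le (dist_ge p hp Y _)).ne'

lemma iid_pos (p : A → ℝ) (hp : IsPMF p) (n : ℕ) (x : Fin n → A) (h : iidW p n x ≠ 0) (t : Fin n) :
    0 < p (x t) := by
  refine lt_of_le_of_ne (hp.1 _) fun h0 => h ?_
  exact Finset.prod_eq_zero (Finset.mem_univ t) h0.symm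

/-- count of typical sequences with a fixed marginal -/
lemma count_bound (p : A → ℝ) (hp : IsPMF p) (Y : A → B) (n : ℕ) (c : ℝ) (x0 : Fin n → A)
    (h0 : ∀ t, 0 < p (x0 t)) (S : Finset (Fin n → A))
    (hS : ∀ x ∈ S, (∀ t, 0 < p (x t)) ∧ ∑ t, dens p Y (x t) ≤ c ∧ ∀ t, Y (x t) = Y (x0 t)) :
    (S.card : ℝ) ≤ (2 : ℝ) ^ c := by
  obtain ⟨P, hP⟩ : ∃ P, P = ∏ t, dist p Y (Y (x0 t)) := ⟨_, rfl⟩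
  have hPpos : 0 < P := hP ▸ Finset.prod_pos fun t _ => (h0 t).trans_le (dist_ge p hp Y _)
  let F : (Fin n → A) → ℝ := fun x => ∏ t, (if Y (x t) = Y (x0 t) then p (x t) else 0)
  have h1 : ∑ x, F x = P := by
    rw [hP]; exact sum_prod n (fun t a => if Y a = Y (x0 t) then p a else 0)
  have h2 : ∀ x ∈ S, P * (2 : ℝ) ^ (-c) ≤ F x := by
    intro x hx
    obtain ⟨ha, hb, hc⟩ := hS x hx
    have e : F x = iidW p n x := by
      simp [F, hc, iidW]
    have e2 : ∏ t, dist p Y (Y (x t)) = P := by simp [hc, hP]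
    have hw : 0 < iidW p n x := Finset.prod_pos fun t _ => ha t
    rw [e]
    rw [dens_iid p hp Y n x ha, e2] at hb
    rw [← Real.logb_le_logb one_lt_two (by positivity) hw, Real.logb_mul hPpos.ne' (by positivity),
      Real.logb_rpow (by norm_num) (by norm_num)]
    linarith
  have h3 : S.card * (P * (2 : ℝ) ^ (-c)) ≤ P := by
    have hnn : ∀ x : Fin n → A, 0 ≤ F x := fun x =>
      Finset.prod_nonneg fun t _ => by split_ifs; exacts [hp.1 _, le_rfl]
    clear_value F
    have h5 : ∑ x ∈ S, F x ≤ ∑ x, F x :=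
      Finset.sum_le_sum_of_subset_of_nonneg (Finset.subset_univ _) fun x _ _ => hnn x
    have h6 := Finset.sum_le_sum h2
    rw [Finset.sum_const, nsmul_eq_mul] at h6
    linarith
  rw [Real.rpow_neg (by norm_num)] at h3
  have hc : (0 : ℝ) < 2 ^ c := by positivity
  have h4 : (S.card : ℝ) * (2 ^ c)⁻¹ ≤ 1 := by
    by_contra hcon
    push Not at hcon
    nlinarith
  rwa [← div_eq_mul_inv, div_le_one hc] at h4

/-- Chernoff bound -/
lemma chernoff (p : A → ℝ) (hp : IsPMF p) (f : A → ℝ) (δ : ℝ) (hδ : 0 < δ) :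
    ∃ r : ℝ, 0 ≤ r ∧ r < 1 ∧ ∀ n : ℕ,
      ∑ x : Fin n → A, (if ∑ t, f (x t) ≤ n * (∑ a, p a * f a + δ) then 0 else iidW p n x)
        ≤ r ^ n := by
  set h := ∑ a, p a * f a with hh
  let φ : ℝ → ℝ := fun s => ∑ a, p a * Real.exp (s * (f a - h - δ))
  have hd : HasDerivAt φ (-δ) 0 := by
    have : HasDerivAt φ (∑ a, p a * (Real.exp (0 * (f a - h - δ)) * (1 * (f a - h - δ)))) 0 := by
      apply HasDerivAt.fun_sum
      intro a _
      exact (((hasDerivAt_id (0 : ℝ)).mul_const (f a - h - δ)).exp).const_mul (p a)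
    convert this using 1
    simp [mul_sub, Finset.sum_sub_distrib, ← Finset.sum_mul, hp.2, ← hh]
  have hφ0 : φ 0 = 1 := by simp [φ, hp.2]
  have hev : ∀ᶠ s in nhdsWithin (0 : ℝ) (Set.Ioi 0), φ s < 1 := by
    have h1 := (hasDerivWithinAt_iff_tendsto_slope' (s := Set.Ioi 0) (by simp)).1
      hd.hasDerivWithinAt
    have h2 := h1.eventually (gt_mem_nhds (show -δ < 0 by linarith))
    filter_upwards [h2, self_mem_nhdsWithin] with s hs hs0
    have hs0 : 0 < s := hs0
    rw [slope_def_field, hφ0, sub_zero, div_neg_iff] at hs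
    rcases hs with hs | hs <;> linarith [hs.1, hs.2]
  obtain ⟨s, hs1, hs0⟩ := (hev.and self_mem_nhdsWithin).exists
  have hs0 : 0 < s := hs0
  have hnn : 0 ≤ φ s := Finset.sum_nonneg fun a _ => mul_nonneg (hp.1 a) (Real.exp_nonneg _)
  refine ⟨φ s, hnn, hs1, fun n => ?_⟩
  have e := sum_prod n (fun _ a => p a * Real.exp (s * (f a - h - δ)))
  have : (φ s) ^ n = ∏ t : Fin n, ∑ a, p a * Real.exp (s * (f a - h - δ)) := by simp [φ]
  rw [this, ← e]
  refine Finset.sum_le_sum fun x _ => ?_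
  rw [Finset.prod_mul_distrib, ← Real.exp_sum]
  have hw : 0 ≤ ∏ t, p (x t) := Finset.prod_nonneg fun t _ => hp.1 _
  split_ifs with hc
  · positivity
  · push Not at hc
    refine le_mul_of_one_le_right hw (Real.one_le_exp ?_)
    rw [← Finset.mul_sum]
    refine mul_nonneg hs0.le ?_
    rw [Finset.sum_sub_distrib, Finset.sum_sub_distrib]
    simp
    linarith

/-- Fano type bound -/
lemma fano {Γ : Type} [Fintype Γ] [Nonempty Γ] [Nonempty A]
    (p : A → ℝ) (hp : IsPMF p) (Y : A → B) (n : ℕ)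
    (G : Finset (Fin n → A)) (J : (Fin n → A) → Γ)
    (hG : ∀ x ∈ G, ∀ y ∈ G, (∀ t, Y (x t) = Y (y t)) → J x = J y → x = y)
    (e l : ℝ) (hl : 0 < l) (hl1 : l < 1)
    (he : ∑ x ∈ Gᶜ, iidW p n x ≤ e) :
    n * ∑ a, p a * dens p Y a ≤ Real.logb 2 (Fintype.card Γ) - Real.logb 2 (1 - l)
      + e * (n * Real.logb 2 (Fintype.card A) - Real.logb 2 l) := by
  set g : ℝ := ((Fintype.card Γ : ℕ) : ℝ) with hg
  have hgpos : 0 < g := by rw [hg]; exact_mod_cast Fintype.card_pos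
  have hg1 : 1 ≤ g := by rw [hg]; exact_mod_cast Fintype.card_pos
  set N : ℝ := (Fintype.card A : ℝ) ^ n with hN
  have hA1 : (1 : ℝ) ≤ Fintype.card A := by exact_mod_cast Fintype.card_pos
  have hN1 : 1 ≤ N := one_le_pow₀ hA1
  have hNpos : 0 < N := by linarith
  have hcardΩ : ((Fintype.card (Fin n → A) : ℕ) : ℝ) = N := by simp [hN]
  set W : (Fin n → A) → ℝ := fun x => ∏ t, dist p Y (Y (x t)) with hW
  have hWnn : ∀ x, 0 ≤ W x := fun x => Finset.prod_nonneg fun t _ => dist_nonneg p hp Y _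
  have hW1 : ∀ x, W x ≤ 1 := fun x =>
    Finset.prod_le_one (fun t _ => dist_nonneg p hp Y _) (fun t _ => dist_le_one p hp Y _)
  have hWall : ∑ x, W x ≤ N := by
    calc ∑ x, W x ≤ ∑ x : Fin n → A, (1 : ℝ) := Finset.sum_le_sum fun x _ => hW1 x
      _ = N := by rw [← hcardΩ]; simp
  have hWG : ∑ x ∈ G, W x ≤ g := by
    have hinj : Set.InjOn (fun x : Fin n → A => (J x, fun t => Y (x t))) (G : Set (Fin n → A)) := by
      intro x hx y hy hxy
      simp only [Prod.mk.injEq] at hxy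
      exact hG x hx y hy (fun t => congrFun hxy.2 t) hxy.1
    calc ∑ x ∈ G, W x
        = ∑ z ∈ G.image (fun x : Fin n → A => (J x, fun t => Y (x t))), ∏ t, dist p Y (z.2 t) := by
          rw [Finset.sum_image hinj]
      _ ≤ ∑ z : Γ × (Fin n → B), ∏ t, dist p Y (z.2 t) :=
          Finset.sum_le_sum_of_subset_of_nonneg (Finset.subset_univ _) fun z _ _ =>
            Finset.prod_nonneg fun t _ => dist_nonneg p hp Y _
      _ = g := by
          rw [Fintype.sum_prod_type]
          simp only
          rw [sum_prod n (fun _ b => dist p Y b)]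
          simp [dist_sum p hp Y, hg]
  set c : (Fin n → A) → ℝ := fun x => (if x ∈ G then (1 - l) / g else 0) + l / N with hc
  have hcpos : ∀ x, 0 < c x := by
    intro x
    have : 0 < l / N := by positivity
    have h1l : 0 < (1 - l) / g := div_pos (by linarith) hgpos
    simp only [hc]; split_ifs <;> linarith
  have hq : ∑ x, W x * c x ≤ 1 := by
    simp only [hc, mul_add, Finset.sum_add_distrib, mul_ite, mul_zero]
    rw [← Finset.sum_mul, ← Finset.sum_filter, ← Finset.sum_mul]
    simp only [Finset.filter_mem_eq_inter, Finset.univ_inter]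
    have h1 : (∑ x ∈ G, W x) * ((1 - l) / g) ≤ g * ((1 - l) / g) :=
      mul_le_mul_of_nonneg_right hWG (div_nonneg (by linarith) hgpos.le)
    have h2 : (∑ x, W x) * (l / N) ≤ N * (l / N) :=
      mul_le_mul_of_nonneg_right hWall (by positivity)
    rw [mul_div_cancel₀ _ hgpos.ne'] at h1
    rw [mul_div_cancel₀ _ hNpos.ne'] at h2
    linarith
  have key : ∀ x, iidW p n x * (∑ t, dens p Y (x t) + Real.logb 2 (c x))
      ≤ (W x * c x - iidW p n x) / Real.log 2 := by
    intro x
    have hlog2 : 0 < Real.log 2 := Real.log_pos one_lt_two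
    by_cases hx : iidW p n x = 0
    · rw [hx]; simp only [zero_mul, sub_zero]
      exact div_nonneg (mul_nonneg (hWnn x) (hcpos x).le) hlog2.le
    · have hpos : 0 < iidW p n x := lt_of_le_of_ne (iid_nonneg p hp.1 n x) (Ne.symm hx)
      have hpt := iid_pos p hp n x hx
      have hWpos : 0 < W x := Finset.prod_pos fun t _ => (hpt t).trans_le (dist_ge p hp Y _)
      rw [dens_iid p hp Y n x hpt]
      have : Real.logb 2 (W x) - Real.logb 2 (iidW p n x) + Real.logb 2 (c x)
          = Real.log (W x * c x / iidW p n x) / Real.log 2 := by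
        rw [Real.log_div (mul_pos hWpos (hcpos x)).ne' hx, Real.log_mul hWpos.ne' (hcpos x).ne']
        simp only [Real.logb]; ring
      change iidW p n x * (Real.logb 2 (W x) - Real.logb 2 (iidW p n x) + Real.logb 2 (c x)) ≤ _
      rw [this, ← mul_div_assoc]
      refine div_le_div_of_nonneg_right ?_ hlog2.le
      have hle := Real.log_le_sub_one_of_pos (x := W x * c x / iidW p n x)
        (div_pos (mul_pos hWpos (hcpos x)) hpos)
      calc iidW p n x * Real.log (W x * c x / iidW p n x)
          ≤ iidW p n x * (W x * c x / iidW p n x - 1) := mul_le_mul_of_nonneg_left hle hpos.le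
        _ = _ := by field_simp
  have hsum := Finset.sum_le_sum fun x (_ : x ∈ (univ : Finset (Fin n → A))) => key x
  simp_rw [mul_add] at hsum
  rw [Finset.sum_add_distrib, iid_expect p hp n, ← Finset.sum_div, Finset.sum_sub_distrib,
    iid_sum p hp.2 n] at hsum
  have hneg : (∑ x, W x * c x - 1) / Real.log 2 ≤ 0 :=
    div_nonpos_of_nonpos_of_nonneg (by linarith) (Real.log_pos one_lt_two).le
  have hLl : Real.logb 2 l ≤ 0 := Real.logb_nonpos one_lt_two hl.le hl1.le
  have hL1l : Real.logb 2 (1 - l) ≤ 0 := Real.logb_nonpos one_lt_two (by linarith) (by linarith)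
  have hLg : 0 ≤ Real.logb 2 g := Real.logb_nonneg one_lt_two hg1
  have hLN : 0 ≤ Real.logb 2 N := Real.logb_nonneg one_lt_two hN1
  have hNlog : Real.logb 2 N = n * Real.logb 2 (Fintype.card A) := by rw [hN, Real.logb_pow]
  have hcl : ∀ x, - (iidW p n x * Real.logb 2 (c x)) ≤
      iidW p n x * (Real.logb 2 g - Real.logb 2 (1 - l))
       + (if x ∈ G then 0 else iidW p n x) * (Real.logb 2 N - Real.logb 2 l) := by
    intro x
    have hw := iid_nonneg p hp.1 n x
    by_cases hx : x ∈ G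
    · simp only [hx, if_true, zero_mul, add_zero]
      rw [← mul_neg]
      refine mul_le_mul_of_nonneg_left ?_ hw
      have : Real.logb 2 ((1 - l) / g) ≤ Real.logb 2 (c x) := by
        apply Real.logb_le_logb_of_le one_lt_two (div_pos (by linarith) hgpos)
        simp only [hc, hx, if_true]
        have : 0 < l / N := by positivity
        linarith
      rw [Real.logb_div (by linarith) hgpos.ne'] at this
      linarith
    · simp only [hx, if_false]
      have : c x = l / N := by simp [hc, hx]
      rw [this, Real.logb_div hl.ne' hNpos.ne']
      nlinarith
  have hs2 := Finset.sum_le_sum fun x (_ : x ∈ (univ : Finset (Fin n → A))) => hcl x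
  rw [Finset.sum_neg_distrib, Finset.sum_add_distrib, ← Finset.sum_mul, ← Finset.sum_mul,
    iid_sum p hp.2 n] at hs2
  have hcompl : ∑ x, (if x ∈ G then 0 else iidW p n x) = ∑ x ∈ Gᶜ, iidW p n x := by
    rw [← Finset.sum_filter_add_sum_filter_not univ (fun x => x ∈ G)]
    rw [Finset.sum_congr rfl (g := fun _ => (0:ℝ))]
    · rw [Finset.sum_const_zero, zero_add]
      refine Finset.sum_congr ?_ ?_
      · ext; simp
      · intro x hx; simp at hx; simp [hx]
    · intro x hx; simp at hx; simp [hx]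
  rw [hcompl] at hs2
  have h3 : (∑ x ∈ Gᶜ, iidW p n x) * (Real.logb 2 N - Real.logb 2 l)
      ≤ e * (Real.logb 2 N - Real.logb 2 l) :=
    mul_le_mul_of_nonneg_right he (by linarith)
  rw [← hNlog]
  linarith

lemma hash_count {U : Type} [Fintype U] (M : ℕ) (hM : 0 < M) (x y : U) (hxy : x ≠ y) :
    ∑ f : U → Fin M, (if f x = f y then (1 : ℝ) else 0)
      = (Fintype.card (U → Fin M) : ℝ) * (M : ℝ)⁻¹ := by
  haveI : NeZero M := ⟨hM.ne'⟩
  have hM' : (M : ℝ) ≠ 0 := by exact_mod_cast hM.ne'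
  have h1 : ∀ c : Fin M, ∑ f : U → Fin M, (if f x = f y + c then (1 : ℝ) else 0)
      = ∑ f : U → Fin M, (if f x = f y then (1 : ℝ) else 0) := by
    intro c
    refine Fintype.sum_equiv (Equiv.subRight (Pi.single x c)) _ _ fun f => ?_
    simp [Pi.single_eq_of_ne hxy.symm, sub_eq_iff_eq_add]
  have h2 : ∑ c : Fin M, ∑ f : U → Fin M, (if f x = f y + c then (1 : ℝ) else 0)
      = (Fintype.card (U → Fin M) : ℝ) := by
    rw [Finset.sum_comm]
    have : ∀ f : U → Fin M, ∑ c : Fin M, (if f x = f y + c then (1 : ℝ) else 0) = 1 := by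
      intro f
      rw [Finset.sum_eq_single (f x - f y)]
      · simp
      · intro c _ hc
        rw [if_neg]
        intro h; apply hc; rw [h]; simp
      · simp
    simp [this]
  simp_rw [h1] at h2
  rw [Finset.sum_const, nsmul_eq_mul] at h2
  simp only [Finset.card_univ, Fintype.card_fin] at h2
  rw [← h2]; field_simp

/-- collision fraction -/
def cf {U : Type} (M : ℕ) (x y : U) : ℝ := if x = y then 1 else (M : ℝ)⁻¹

lemma hash_count' {U : Type} [Fintype U] (M : ℕ) (hM : 0 < M) (x y : U) :
    ∑ f : U → Fin M, (if f x = f y then (1 : ℝ) else 0)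
      = (Fintype.card (U → Fin M) : ℝ) * cf M x y := by
  unfold cf
  split_ifs with h
  · subst h; simp
  · exact hash_count M hM x y h

lemma ite_and3 (a b c : Prop) [Decidable a] [Decidable b] [Decidable c] : (if a ∧ b ∧ c then (1 : ℝ) else 0) =
    (if a then (1 : ℝ) else 0) * ((if b then (1 : ℝ) else 0) * (if c then (1 : ℝ) else 0)) := by
  by_cases a <;> by_cases b <;> by_cases c <;> simp_all

/-- bad collision set -/
def coll {Ω U1 U2 U3 V1 V2 V3 : Type} (T : Finset Ω) (u1 : Ω → U1) (u2 : Ω → U2) (u3 : Ω → U3)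
    (F1 : U1 → V1) (F2 : U2 → V2) (F3 : U3 → V3) (x : Ω) : Finset Ω :=
  T.filter fun y => (y ≠ x ∧ (u1 x = u1 y ∨ u2 x = u2 y ∨ u3 x = u3 y)) ∧
    F1 (u1 x) = F1 (u1 y) ∧ F2 (u2 x) = F2 (u2 y) ∧ F3 (u3 x) = F3 (u3 y)

lemma binning {Ω U1 U2 U3 : Type} [Fintype Ω] [Fintype U1] [Fintype U2] [Fintype U3]
    (T : Finset Ω) (w : Ω → ℝ) (hw : IsPMF w)
    (u1 : Ω → U1) (u2 : Ω → U2) (u3 : Ω → U3)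
    (hinj : ∀ x y, u1 x = u1 y → u2 x = u2 y → u3 x = u3 y → x = y)
    (M1 M2 M3 : ℕ) (h1 : 0 < M1) (h2 : 0 < M2) (h3 : 0 < M3) (C1 C2 C3 C12 C13 C23 : ℝ)
    (c1 : 0 ≤ C1) (c2 : 0 ≤ C2) (c3 : 0 ≤ C3)
    (c12 : 0 ≤ C12) (c13 : 0 ≤ C13) (c23 : 0 ≤ C23)
    (b1 : ∀ x ∈ T, ((T.filter fun y => u2 x = u2 y ∧ u3 x = u3 y).card : ℝ) ≤ C1)
    (b2 : ∀ x ∈ T, ((T.filter fun y => u1 x = u1 y ∧ u3 x = u3 y).card : ℝ) ≤ C2)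
    (b3 : ∀ x ∈ T, ((T.filter fun y => u1 x = u1 y ∧ u2 x = u2 y).card : ℝ) ≤ C3)
    (b12 : ∀ x ∈ T, ((T.filter fun y => u3 x = u3 y).card : ℝ) ≤ C12)
    (b13 : ∀ x ∈ T, ((T.filter fun y => u2 x = u2 y).card : ℝ) ≤ C13)
    (b23 : ∀ x ∈ T, ((T.filter fun y => u1 x = u1 y).card : ℝ) ≤ C23) :
    ∃ (F1 : U1 → Fin M1) (F2 : U2 → Fin M2) (F3 : U3 → Fin M3),
      ∑ x ∈ T, w x * ((coll T u1 u2 u3 F1 F2 F3 x).card : ℝ) ≤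
        C1 * (M1 : ℝ)⁻¹ + C2 * (M2 : ℝ)⁻¹ + C3 * (M3 : ℝ)⁻¹
        + C12 * ((M1 : ℝ)⁻¹ * (M2 : ℝ)⁻¹) + C13 * ((M1 : ℝ)⁻¹ * (M3 : ℝ)⁻¹)
        + C23 * ((M2 : ℝ)⁻¹ * (M3 : ℝ)⁻¹) := by
  haveI : NeZero M1 := ⟨h1.ne'⟩
  haveI : NeZero M2 := ⟨h2.ne'⟩
  haveI : NeZero M3 := ⟨h3.ne'⟩
  set i1 : ℝ := (M1 : ℝ)⁻¹ with hi1
  set i2 : ℝ := (M2 : ℝ)⁻¹ with hi2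
  set i3 : ℝ := (M3 : ℝ)⁻¹ with hi3
  have p1 : 0 ≤ i1 := by positivity
  have p2 : 0 ≤ i2 := by positivity
  have p3 : 0 ≤ i3 := by positivity
  set Q := C1 * i1 + C2 * i2 + C3 * i3 + C12 * (i1 * i2) + C13 * (i1 * i3) + C23 * (i2 * i3)
    with hQ
  -- pointwise bound for pairs
  have pair : ∀ x y, (if (y ≠ x ∧ (u1 x = u1 y ∨ u2 x = u2 y ∨ u3 x = u3 y)) then
      cf M1 (u1 x) (u1 y) * cf M2 (u2 x) (u2 y) * cf M3 (u3 x) (u3 y) else 0) ≤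
      (if u2 x = u2 y ∧ u3 x = u3 y then (1 : ℝ) else 0) * i1
      + (if u1 x = u1 y ∧ u3 x = u3 y then (1 : ℝ) else 0) * i2
      + (if u1 x = u1 y ∧ u2 x = u2 y then (1 : ℝ) else 0) * i3
      + (if u3 x = u3 y then (1 : ℝ) else 0) * (i1 * i2)
      + (if u2 x = u2 y then (1 : ℝ) else 0) * (i1 * i3)
      + (if u1 x = u1 y then (1 : ℝ) else 0) * (i2 * i3) := by
    intro x y
    have q12 := mul_nonneg p1 p2
    have q13 := mul_nonneg p1 p3
    have q23 := mul_nonneg p2 p3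
    by_cases a1 : u1 x = u1 y <;> by_cases a2 : u2 x = u2 y <;> by_cases a3 : u3 x = u3 y <;>
      simp only [cf, a1, a2, a3, ← hi1, ← hi2, ← hi3, if_true, if_false, and_true, true_and,
        and_false, false_and, or_true, true_or, or_false, false_or, one_mul, mul_one, zero_mul,
        add_zero, zero_add, le_refl]
    · have := hinj x y a1 a2 a3
      simp [this]
      positivity
    all_goals (try split_ifs)
    all_goals first | positivity | linarith
  have hx : ∀ x ∈ T, ∑ y ∈ T, (if (y ≠ x ∧ (u1 x = u1 y ∨ u2 x = u2 y ∨ u3 x = u3 y)) then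
      cf M1 (u1 x) (u1 y) * cf M2 (u2 x) (u2 y) * cf M3 (u3 x) (u3 y) else 0) ≤ Q := by
    intro x hxT
    refine (Finset.sum_le_sum fun y _ => pair x y).trans ?_
    simp only [Finset.sum_add_distrib, ← Finset.sum_mul, Finset.sum_boole]
    rw [hQ]
    gcongr
    exacts [b1 x hxT, b2 x hxT, b3 x hxT, b12 x hxT, b13 x hxT, b23 x hxT]
  -- averaging
  let Φ := (U1 → Fin M1) × (U2 → Fin M2) × (U3 → Fin M3)
  have hcard : ((Fintype.card Φ : ℕ) : ℝ) = (Fintype.card (U1 → Fin M1) : ℝ) *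
      ((Fintype.card (U2 → Fin M2) : ℝ) * (Fintype.card (U3 → Fin M3) : ℝ)) := by
    simp only [Φ, Fintype.card_prod, Nat.cast_mul]
  have hpairF : ∀ x y, ∑ F : Φ, (if (y ≠ x ∧ (u1 x = u1 y ∨ u2 x = u2 y ∨ u3 x = u3 y)) ∧
      F.1 (u1 x) = F.1 (u1 y) ∧ F.2.1 (u2 x) = F.2.1 (u2 y) ∧ F.2.2 (u3 x) = F.2.2 (u3 y)
      then (1 : ℝ) else 0) = (Fintype.card Φ : ℝ) *
      (if (y ≠ x ∧ (u1 x = u1 y ∨ u2 x = u2 y ∨ u3 x = u3 y)) then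
      cf M1 (u1 x) (u1 y) * cf M2 (u2 x) (u2 y) * cf M3 (u3 x) (u3 y) else 0) := by
    intro x y
    suffices hs : ∀ (D : Prop) [Decidable D], ∑ F : Φ, (if D ∧
      F.1 (u1 x) = F.1 (u1 y) ∧ F.2.1 (u2 x) = F.2.1 (u2 y) ∧ F.2.2 (u3 x) = F.2.2 (u3 y)
      then (1 : ℝ) else 0) = (Fintype.card Φ : ℝ) * (if D then
      cf M1 (u1 x) (u1 y) * cf M2 (u2 x) (u2 y) * cf M3 (u3 x) (u3 y) else 0) from hs _
    intro D _
    by_cases hD : D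
    · simp only [hD, true_and, if_true]
      have e : ∀ F : Φ, (if F.1 (u1 x) = F.1 (u1 y) ∧ F.2.1 (u2 x) = F.2.1 (u2 y) ∧
          F.2.2 (u3 x) = F.2.2 (u3 y) then (1 : ℝ) else 0) =
          (if F.1 (u1 x) = F.1 (u1 y) then (1 : ℝ) else 0) *
          ((if F.2.1 (u2 x) = F.2.1 (u2 y) then (1 : ℝ) else 0) *
          (if F.2.2 (u3 x) = F.2.2 (u3 y) then (1 : ℝ) else 0)) := by
        intro F
        exact ite_and3 _ _ _
      rw [Finset.sum_congr rfl fun F _ => e F]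
      rw [hcard, Fintype.sum_prod_type]
      have e1 : ∀ (f : (U1 → Fin M1) → ℝ) (g : (U2 → Fin M2) → ℝ) (h : (U3 → Fin M3) → ℝ),
          ∑ a, ∑ b : (U2 → Fin M2) × (U3 → Fin M3), f a * (g b.1 * h b.2)
            = (∑ a, f a) * ((∑ a, g a) * ∑ a, h a) := by
        intro f g h
        have e2 : (∑ a, g a) * ∑ a, h a = ∑ b : (U2 → Fin M2) × (U3 → Fin M3), g b.1 * h b.2 := by
          rw [Finset.sum_mul_sum, Fintype.sum_prod_type]
        rw [e2, Finset.sum_mul_sum]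
      rw [e1 (fun F => if F (u1 x) = F (u1 y) then 1 else 0)
        (fun F => if F (u2 x) = F (u2 y) then 1 else 0)
        (fun F => if F (u3 x) = F (u3 y) then 1 else 0)]
      have g1 := hash_count' M1 h1 (u1 x) (u1 y)
      have g2 := hash_count' M2 h2 (u2 x) (u2 y)
      have g3 := hash_count' M3 h3 (u3 x) (u3 y)
      rw [g1, g2, g3]; ring
    · simp only [hD, false_and, if_false, mul_zero, Finset.sum_const_zero]
  have hcollcard : ∀ (F : Φ) x, ((coll T u1 u2 u3 F.1 F.2.1 F.2.2 x).card : ℝ) =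
      ∑ y ∈ T, (if (y ≠ x ∧ (u1 x = u1 y ∨ u2 x = u2 y ∨ u3 x = u3 y)) ∧
      F.1 (u1 x) = F.1 (u1 y) ∧ F.2.1 (u2 x) = F.2.1 (u2 y) ∧ F.2.2 (u3 x) = F.2.2 (u3 y)
      then (1 : ℝ) else 0) := by
    intro F x
    rw [Finset.sum_boole]; unfold coll; congr!
  have hQ0 : 0 ≤ Q := by rw [hQ]; positivity
  have htot : ∑ F : Φ, ∑ x ∈ T, w x * ((coll T u1 u2 u3 F.1 F.2.1 F.2.2 x).card : ℝ)
      ≤ ∑ F : Φ, Q := by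
    rw [Finset.sum_comm, Finset.sum_const, nsmul_eq_mul, Finset.card_univ]
    calc _ = ∑ x ∈ T, w x * ((Fintype.card Φ : ℝ) * ∑ y ∈ T,
          (if (y ≠ x ∧ (u1 x = u1 y ∨ u2 x = u2 y ∨ u3 x = u3 y)) then
          cf M1 (u1 x) (u1 y) * cf M2 (u2 x) (u2 y) * cf M3 (u3 x) (u3 y) else 0)) := by
          refine Finset.sum_congr rfl fun x _ => ?_
          rw [← Finset.mul_sum]
          congr 1
          rw [Finset.sum_congr rfl fun F _ => hcollcard F x, Finset.sum_comm, Finset.mul_sum]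
          exact Finset.sum_congr rfl fun y _ => hpairF x y
      _ ≤ ∑ x ∈ T, w x * ((Fintype.card Φ : ℝ) * Q) := by
          refine Finset.sum_le_sum fun x hxT => ?_
          refine mul_le_mul_of_nonneg_left ?_ (hw.1 x)
          exact mul_le_mul_of_nonneg_left (hx x hxT) (Nat.cast_nonneg _)
      _ = (∑ x ∈ T, w x) * ((Fintype.card Φ : ℝ) * Q) := by rw [Finset.sum_mul]
      _ ≤ 1 * ((Fintype.card Φ : ℝ) * Q) := by
          refine mul_le_mul_of_nonneg_right ?_ (by positivity)
          rw [← hw.2]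
          exact Finset.sum_le_sum_of_subset_of_nonneg (Finset.subset_univ _) fun x _ _ => hw.1 x
      _ = _ := one_mul _
  obtain ⟨F, _, hF⟩ := Finset.exists_le_of_sum_le (Finset.univ_nonempty (α := Φ)) htot
  exact ⟨F.1, F.2.1, F.2.2, hF⟩

lemma pr_le {Ω : Type} [Fintype Ω] [DecidableEq Ω] (w : Ω → ℝ) (hw : ∀ x, 0 ≤ w x) (T : Finset Ω)
    (N : Ω → Finset Ω) (E : Ω → Prop) (h : ∀ x ∈ T, N x = ∅ → ¬ E x) :
    pr w E ≤ ∑ x ∈ Tᶜ, w x + ∑ x ∈ T, w x * ((N x).card : ℝ) := by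
  unfold IT.pr
  rw [← Finset.sum_compl_add_sum T]
  refine add_le_add (Finset.sum_le_sum fun x _ => ?_) (Finset.sum_le_sum fun x hx => ?_)
  · split_ifs; exacts [le_rfl, hw x]
  · split_ifs with hE
    · refine le_mul_of_one_le_right (hw x) ?_
      have : (N x).Nonempty := by
        rw [Finset.nonempty_iff_ne_empty]; exact fun h0 => h x hx h0 hE
      exact_mod_cast this.card_pos
    · exact mul_nonneg (hw x) (Nat.cast_nonneg _)

lemma det {X1 X2 X3 : Type} {n K : ℕ} {m1 m2 m3 : Fin K → ℕ}
    (J1 : (l : Fin K) → (Fin n → X1 × X2 × X3) → Fin (m1 l))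
    (J2 : (l : Fin K) → (Fin n → X1 × X2 × X3) → Fin (m2 l))
    (J3 : (l : Fin K) → (Fin n → X1 × X2 × X3) → Fin (m3 l))
    (c1 : ∀ l : Fin K, ∃ f : (Fin n → X1) →
            ((k : Fin K) → k.val < l.val → Fin (m2 k)) →
            ((k : Fin K) → k.val < l.val → Fin (m3 k)) → Fin (m1 l),
          ∀ ω, J1 l ω = f (fun t => (ω t).1) (fun k _ => J2 k ω) (fun k _ => J3 k ω))
    (c2 : ∀ l : Fin K, ∃ f : (Fin n → X2) →
            ((k : Fin K) → k.val ≤ l.val → Fin (m1 k)) →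
            ((k : Fin K) → k.val < l.val → Fin (m3 k)) → Fin (m2 l),
          ∀ ω, J2 l ω = f (fun t => (ω t).2.1) (fun k _ => J1 k ω) (fun k _ => J3 k ω))
    (c3 : ∀ l : Fin K, ∃ f : (Fin n → X3) →
            ((k : Fin K) → k.val ≤ l.val → Fin (m1 k)) →
            ((k : Fin K) → k.val ≤ l.val → Fin (m2 k)) → Fin (m3 l),
          ∀ ω, J3 l ω = f (fun t => (ω t).2.2) (fun k _ => J1 k ω) (fun k _ => J2 k ω))
    (x y : Fin n → X1 × X2 × X3)
    (d1 : (∀ t, (x t).1 = (y t).1) ∨ ∀ l, J1 l x = J1 l y)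
    (d2 : (∀ t, (x t).2.1 = (y t).2.1) ∨ ∀ l, J2 l x = J2 l y)
    (d3 : (∀ t, (x t).2.2 = (y t).2.2) ∨ ∀ l, J3 l x = J3 l y) :
    ∀ l, J1 l x = J1 l y ∧ J2 l x = J2 l y ∧ J3 l x = J3 l y := by
  suffices h : ∀ (N : ℕ) (l : Fin K), l.val < N →
      J1 l x = J1 l y ∧ J2 l x = J2 l y ∧ J3 l x = J3 l y from fun l => h (l.val + 1) l (by omega)
  intro N
  induction N with
  | zero => intro l hl; omega
  | succ N ih =>
    intro l hl
    have ih1 : ∀ k : Fin K, k.val < l.val → J1 k x = J1 k y := fun k hk => (ih k (by omega)).1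
    have ih2 : ∀ k : Fin K, k.val < l.val → J2 k x = J2 k y := fun k hk => (ih k (by omega)).2.1
    have ih3 : ∀ k : Fin K, k.val < l.val → J3 k x = J3 k y := fun k hk => (ih k (by omega)).2.2
    have e1 : J1 l x = J1 l y := by
      rcases d1 with d | d
      · obtain ⟨f, hf⟩ := c1 l
        rw [hf x, hf y]
        congr 1
        · funext t; exact d t
        · funext k hk; exact ih2 k hk
        · funext k hk; exact ih3 k hk
      · exact d l
    have ih1' : ∀ k : Fin K, k.val ≤ l.val → J1 k x = J1 k y := by
      intro k hk
      rcases hk.lt_or_eq with h | h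
      · exact ih1 k h
      · rw [Fin.ext h]; exact e1
    have e2 : J2 l x = J2 l y := by
      rcases d2 with d | d
      · obtain ⟨f, hf⟩ := c2 l
        rw [hf x, hf y]
        congr 1
        · funext t; exact d t
        · funext k hk; exact ih1' k hk
        · funext k hk; exact ih3 k hk
      · exact d l
    have ih2' : ∀ k : Fin K, k.val ≤ l.val → J2 k x = J2 k y := by
      intro k hk
      rcases hk.lt_or_eq with h | h
      · exact ih2 k h
      · rw [Fin.ext h]; exact e2
    have e3 : J3 l x = J3 l y := by
      rcases d3 with d | d
      · obtain ⟨f, hf⟩ := c3 l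
        rw [hf x, hf y]
        congr 1
        · funext t; exact d t
        · funext k hk; exact ih1' k hk
        · funext k hk; exact ih2' k hk
      · exact d l
    exact ⟨e1, e2, e3⟩

lemma logb_card_pi {K : ℕ} (m : Fin K → ℕ) (hm : ∀ l, 0 < m l) :
    Real.logb 2 ((Fintype.card ((l : Fin K) → Fin (m l)) : ℕ) : ℝ) = ∑ l, Real.logb 2 (m l) := by
  rw [Fintype.card_pi]
  simp only [Fintype.card_fin, Nat.cast_prod]
  rw [Real.logb_prod]
  intro l _
  exact_mod_cast (hm l).ne'

lemma conv_limit (h R L : ℝ)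
    (H : ∀ ε : ℝ, 0 < ε → ε < 1 / 2 →
      h ≤ R + 2 * ε - Real.logb 2 (1 - ε) + 2 * ε * (L - Real.logb 2 ε)) : h ≤ R := by
  have ht : Filter.Tendsto (fun ε : ℝ => R + 2 * ε - Real.log (1 - ε) / Real.log 2
      + 2 * (ε * L) + 2 * (Real.negMulLog ε / Real.log 2)) (nhdsWithin 0 (Set.Ioi 0)) (nhds R) := by
    have hc : ContinuousAt (fun ε : ℝ => R + 2 * ε - Real.log (1 - ε) / Real.log 2
      + 2 * (ε * L) + 2 * (Real.negMulLog ε / Real.log 2)) 0 := by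
      have h1 : ContinuousAt (fun ε : ℝ => Real.log (1 - ε)) 0 :=
        ContinuousAt.log (by fun_prop) (by norm_num)
      have h2 : ContinuousAt Real.negMulLog 0 := Real.continuous_negMulLog.continuousAt
      fun_prop
    have := hc.tendsto.mono_left (nhdsWithin_le_nhds (s := Set.Ioi 0))
    simpa using this
  refine ge_of_tendsto ht ?_
  have : Set.Ioo (0 : ℝ) (1 / 2) ∈ nhdsWithin (0 : ℝ) (Set.Ioi 0) :=
    Ioo_mem_nhdsGT (by norm_num)
  filter_upwards [this] with ε hε
  refine (H ε hε.1 hε.2).trans (le_of_eq ?_)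
  simp only [Real.logb, Real.negMulLog]
  ring

lemma pr_or {Ω : Type} [Fintype Ω] (w : Ω → ℝ) (hw : ∀ x, 0 ≤ w x) (E F : Ω → Prop) :
    pr w (fun x => E x ∨ F x) ≤ pr w E + pr w F := by
  unfold IT.pr
  rw [← Finset.sum_add_distrib]
  refine Finset.sum_le_sum fun x _ => ?_
  have := hw x
  by_cases h1 : E x <;> by_cases h2 : F x <;> simp [h1, h2, this]

lemma conv_step {Γ : Type} [Fintype Γ] [Nonempty Γ] [Nonempty A]
    (p : A → ℝ) (hp : IsPMF p) (Y : A → B) (n : ℕ) (hn : 0 < n)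
    (E : (Fin n → A) → Prop) (J : (Fin n → A) → Γ)
    (hG : ∀ x y, ¬ E x → ¬ E y → (∀ t, Y (x t) = Y (y t)) → J x = J y → x = y)
    (R ε : ℝ) (hε : 0 < ε) (hε1 : ε < 1 / 2)
    (hR : Real.logb 2 (Fintype.card Γ) ≤ n * (R + 2 * ε))
    (he : pr (iidW p n) E ≤ 2 * ε) :
    ∑ a, p a * dens p Y a ≤ R + 2 * ε - Real.logb 2 (1 - ε)
      + 2 * ε * (Real.logb 2 (Fintype.card A) - Real.logb 2 ε) := by
  have h := fano p hp Y n (univ.filter fun x => ¬ E x) J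
    (fun x hx y hy => hG x y (by simpa using hx) (by simpa using hy)) (2 * ε) ε hε (by linarith)
    (by
      refine le_trans (le_of_eq ?_) he
      unfold IT.pr
      rw [← Finset.sum_filter]
      refine Finset.sum_congr ?_ fun _ _ => rfl
      ext; simp)
  have hn1 : (1 : ℝ) ≤ n := by exact_mod_cast hn
  have hn0 : (0 : ℝ) < n := by linarith
  have l1 : Real.logb 2 ε ≤ 0 := Real.logb_nonpos one_lt_two hε.le (by linarith)
  have l2 : Real.logb 2 (1 - ε) ≤ 0 := Real.logb_nonpos one_lt_two (by linarith) (by linarith)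
  have l3 : - Real.logb 2 (1 - ε) ≤ n * (- Real.logb 2 (1 - ε)) :=
    le_mul_of_one_le_left (by linarith) hn1
  have l4 : 2 * ε * (- Real.logb 2 ε) ≤ n * (2 * ε * (- Real.logb 2 ε)) :=
    le_mul_of_one_le_left (mul_nonneg (by linarith) (by linarith)) hn1
  refine le_of_mul_le_mul_left ?_ hn0
  linarith

lemma Mlem (n : ℕ) (hn : 0 < n) (r : ℝ) (hr : 0 ≤ r) :
    0 < ⌊(2 : ℝ) ^ (n * r)⌋₊ ∧ (1 / (n : ℝ)) * Real.logb 2 (⌊(2 : ℝ) ^ (n * r)⌋₊ : ℝ) ≤ r ∧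
    ((⌊(2 : ℝ) ^ (n * r)⌋₊ : ℝ))⁻¹ ≤ 2 * (2 : ℝ) ^ (-(n * r)) := by
  have hn0 : (0 : ℝ) < n := by exact_mod_cast hn
  have h1 : (1 : ℝ) ≤ 2 ^ (n * r) := Real.one_le_rpow (by norm_num) (by positivity)
  have hpos : 0 < ⌊(2 : ℝ) ^ (n * r)⌋₊ := Nat.floor_pos.2 h1
  have hpos' : (0 : ℝ) < (⌊(2 : ℝ) ^ (n * r)⌋₊ : ℝ) := by exact_mod_cast hpos
  have hge : (1 : ℝ) ≤ (⌊(2 : ℝ) ^ (n * r)⌋₊ : ℝ) := by exact_mod_cast hpos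
  have hle : (⌊(2 : ℝ) ^ (n * r)⌋₊ : ℝ) ≤ 2 ^ (n * r) := Nat.floor_le (by positivity)
  refine ⟨hpos, ?_, ?_⟩
  · have := Real.logb_le_logb_of_le one_lt_two hpos' hle
    rw [Real.logb_rpow (by norm_num) (by norm_num)] at this
    rw [one_div, inv_mul_le_iff₀ hn0]
    exact this
  · have h2 : (2 : ℝ) ^ (n * r) < ⌊(2 : ℝ) ^ (n * r)⌋₊ + 1 := Nat.lt_floor_add_one _
    rw [Real.rpow_neg (by norm_num), ← div_eq_mul_inv, inv_le_comm₀ hpos' (by positivity), inv_div,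
      div_le_iff₀ (by norm_num)]
    linarith

lemma term1 (n : ℕ) (h δ R i : ℝ) (hR : h ≤ R)
    (h1 : i ≤ 2 * (2 : ℝ) ^ (-(n * (R + 2 * δ)))) :
    (2 : ℝ) ^ (n * (h + δ)) * i ≤ 4 * ((2 : ℝ) ^ (-δ)) ^ n := by
  have hn0 : (0 : ℝ) ≤ n := Nat.cast_nonneg _
  calc (2 : ℝ) ^ (n * (h + δ)) * i
      ≤ (2 : ℝ) ^ (n * (h + δ)) * (2 * (2 : ℝ) ^ (-(n * (R + 2 * δ)))) := by gcongr
    _ = 2 * (2 : ℝ) ^ (n * (h + δ) + -(n * (R + 2 * δ))) := by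
        rw [Real.rpow_add (by norm_num)]; ring
    _ ≤ 2 * (2 : ℝ) ^ (-δ * n) := by
        gcongr
        · norm_num
        · nlinarith
    _ = 2 * ((2 : ℝ) ^ (-δ)) ^ n := by rw [Real.rpow_mul (by norm_num), Real.rpow_natCast]
    _ ≤ _ := by
        have : (0 : ℝ) ≤ ((2 : ℝ) ^ (-δ)) ^ n := by positivity
        linarith

lemma term2 (n : ℕ) (h δ R R' i i' : ℝ) (hδ : 0 ≤ δ) (hR : h ≤ R + R') (hi : 0 ≤ i')
    (h1 : i ≤ 2 * (2 : ℝ) ^ (-(n * (R + 2 * δ)))) (h2 : i' ≤ 2 * (2 : ℝ) ^ (-(n * (R' + 2 * δ)))) :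
    (2 : ℝ) ^ (n * (h + δ)) * (i * i') ≤ 4 * ((2 : ℝ) ^ (-δ)) ^ n := by
  have hn0 : (0 : ℝ) ≤ n := Nat.cast_nonneg _
  calc (2 : ℝ) ^ (n * (h + δ)) * (i * i')
      ≤ (2 : ℝ) ^ (n * (h + δ)) * ((2 * (2 : ℝ) ^ (-(n * (R + 2 * δ)))) *
          (2 * (2 : ℝ) ^ (-(n * (R' + 2 * δ))))) := by gcongr
    _ = 4 * (2 : ℝ) ^ (n * (h + δ) + -(n * (R + 2 * δ)) + -(n * (R' + 2 * δ))) := by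
        rw [Real.rpow_add (by norm_num), Real.rpow_add (by norm_num)]; ring
    _ ≤ 4 * (2 : ℝ) ^ (-δ * n) := by
        gcongr
        · norm_num
        · nlinarith [mul_nonneg hn0 hδ, mul_le_mul_of_nonneg_left hR hn0]
    _ = 4 * ((2 : ℝ) ^ (-δ)) ^ n := by rw [Real.rpow_mul (by norm_num), Real.rpow_natCast]

lemma ite6 (a b c d e f : Prop) [Decidable a] [Decidable b] [Decidable c] [Decidable d]
    [Decidable e] [Decidable f] (w : ℝ) (hw : 0 ≤ w) (h : ¬ (a ∧ b ∧ c ∧ d ∧ e ∧ f)) :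
    w ≤ (if a then 0 else w) + (if b then 0 else w) + (if c then 0 else w)
      + (if d then 0 else w) + (if e then 0 else w) + (if f then 0 else w) := by
  have hn : ∀ (P : Prop) [Decidable P], 0 ≤ (if P then 0 else w) := by
    intro P _; split_ifs; exacts [le_rfl, hw]
  have := hn a
  have := hn b
  have := hn c
  have := hn d
  have := hn e
  have := hn f
  have hex : ¬a ∨ ¬b ∨ ¬c ∨ ¬d ∨ ¬e ∨ ¬f := by tauto
  rcases hex with g | g | g | g | g | g <;> simp only [g, if_false] at * <;> linarith

lemma mem_filter_any {α : Type} {P : α → Prop} {d : DecidablePred P} {s : Finset α} {a : α}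
    (h : a ∈ @Finset.filter α P d s) : a ∈ s ∧ P a := by
  simpa using h

lemma ach {X1 X2 X3 : Type} [Fintype X1] [Fintype X2] [Fintype X3]
    (p : X1 × X2 × X3 → ℝ) (hp : IsPMF p) (R1 R2 R3 : ℝ)
    (k1 : ∑ a, p a * dens p (fun a => (a.2.1, a.2.2)) a ≤ R1)
    (k2 : ∑ a, p a * dens p (fun a => (a.1, a.2.2)) a ≤ R2)
    (k3 : ∑ a, p a * dens p (fun a => (a.1, a.2.1)) a ≤ R3)
    (k12 : ∑ a, p a * dens p (fun a => a.2.2) a ≤ R1 + R2)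
    (k13 : ∑ a, p a * dens p (fun a => a.2.1) a ≤ R1 + R3)
    (k23 : ∑ a, p a * dens p (fun a => a.1) a ≤ R2 + R3)
    (ε : ℝ) (hε : 0 < ε) :
    ∃ (n M1 M2 M3 : ℕ), 0 < n ∧ 0 < M1 ∧ 0 < M2 ∧ 0 < M3 ∧
      (1 / (n : ℝ)) * Real.logb 2 M1 ≤ R1 + ε ∧
      (1 / (n : ℝ)) * Real.logb 2 M2 ≤ R2 + ε ∧
      (1 / (n : ℝ)) * Real.logb 2 M3 ≤ R3 + ε ∧
      ∃ (F1 : (Fin n → X1) → Fin M1) (F2 : (Fin n → X2) → Fin M2) (F3 : (Fin n → X3) → Fin M3)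
        (T : Finset (Fin n → X1 × X2 × X3)),
        ∑ x ∈ Tᶜ, iidW p n x + ∑ x ∈ T, iidW p n x *
          ((coll T (fun x t => (x t).1) (fun x t => (x t).2.1) (fun x t => (x t).2.2)
            F1 F2 F3 x).card : ℝ) ≤ ε := by
  have z1 := (dens_sum_nonneg p hp _).trans k1
  have z2 := (dens_sum_nonneg p hp _).trans k2
  have z3 := (dens_sum_nonneg p hp _).trans k3
  obtain ⟨δ, hδ⟩ : ∃ δ, δ = ε / 2 := ⟨_, rfl⟩
  have hδ0 : 0 < δ := by linarith
  have hε2 : ε = 2 * δ := by linarith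
  obtain ⟨r1, a1, a1', g1⟩ := chernoff p hp (dens p (fun a => (a.2.1, a.2.2))) δ hδ0
  obtain ⟨r2, a2, a2', g2⟩ := chernoff p hp (dens p (fun a => (a.1, a.2.2))) δ hδ0
  obtain ⟨r3, a3, a3', g3⟩ := chernoff p hp (dens p (fun a => (a.1, a.2.1))) δ hδ0
  obtain ⟨r4, a4, a4', g4⟩ := chernoff p hp (dens p (fun a => a.2.2)) δ hδ0
  obtain ⟨r5, a5, a5', g5⟩ := chernoff p hp (dens p (fun a => a.2.1)) δ hδ0
  obtain ⟨r6, a6, a6', g6⟩ := chernoff p hp (dens p (fun a => a.1)) δ hδ0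
  have hρ : (2 : ℝ) ^ (-δ) < 1 := Real.rpow_lt_one_of_one_lt_of_neg (by norm_num) (by linarith)
  have hρ0 : (0 : ℝ) ≤ (2 : ℝ) ^ (-δ) := by positivity
  have hlim : Filter.Tendsto (fun n : ℕ => r1 ^ n + r2 ^ n + r3 ^ n + r4 ^ n + r5 ^ n + r6 ^ n
      + 24 * ((2 : ℝ) ^ (-δ)) ^ n) Filter.atTop (nhds (0 + 0 + 0 + 0 + 0 + 0 + 24 * 0)) := by
    refine Filter.Tendsto.add (Filter.Tendsto.add (Filter.Tendsto.add (Filter.Tendsto.add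
      (Filter.Tendsto.add (Filter.Tendsto.add ?_ ?_) ?_) ?_) ?_) ?_)
      (Filter.Tendsto.const_mul 24 ?_) <;>
      apply tendsto_pow_atTop_nhds_zero_of_lt_one <;> assumption
  obtain ⟨n, hn1, hn⟩ := ((hlim.eventually (gt_mem_nhds (show
    (0 : ℝ) + 0 + 0 + 0 + 0 + 0 + 24 * 0 < ε by linarith))).and
      (Filter.eventually_gt_atTop 0)).exists
  obtain ⟨q1, s1, t1⟩ := Mlem n hn (R1 + ε) (by linarith)
  obtain ⟨q2, s2, t2⟩ := Mlem n hn (R2 + ε) (by linarith)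
  obtain ⟨q3, s3, t3⟩ := Mlem n hn (R3 + ε) (by linarith)
  generalize ⌊(2 : ℝ) ^ (n * (R1 + ε))⌋₊ = M1 at q1 s1 t1
  generalize ⌊(2 : ℝ) ^ (n * (R2 + ε))⌋₊ = M2 at q2 s2 t2
  generalize ⌊(2 : ℝ) ^ (n * (R3 + ε))⌋₊ = M3 at q3 s3 t3
  refine ⟨n, M1, M2, M3, hn, q1, q2, q3, s1, s2, s3, ?_⟩
  rw [hε2] at t1 t2 t3
  replace g1 := g1 n
  replace g2 := g2 n
  replace g3 := g3 n
  replace g4 := g4 n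
  replace g5 := g5 n
  replace g6 := g6 n
  generalize hh1 : ∑ a, p a * dens p (fun a => (a.2.1, a.2.2)) a = h1 at *
  generalize hh2 : ∑ a, p a * dens p (fun a => (a.1, a.2.2)) a = h2 at *
  generalize hh3 : ∑ a, p a * dens p (fun a => (a.1, a.2.1)) a = h3 at *
  generalize hh4 : ∑ a, p a * dens p (fun a => a.2.2) a = h4 at *
  generalize hh5 : ∑ a, p a * dens p (fun a => a.2.1) a = h5 at *
  generalize hh6 : ∑ a, p a * dens p (fun a => a.1) a = h6 at *
  let T : Finset (Fin n → X1 × X2 × X3) := univ.filter fun x => (∀ t, 0 < p (x t)) ∧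
    ∑ t, dens p (fun a => (a.2.1, a.2.2)) (x t) ≤ n * (h1 + δ) ∧
    ∑ t, dens p (fun a => (a.1, a.2.2)) (x t) ≤ n * (h2 + δ) ∧
    ∑ t, dens p (fun a => (a.1, a.2.1)) (x t) ≤ n * (h3 + δ) ∧
    ∑ t, dens p (fun a => a.2.2) (x t) ≤ n * (h4 + δ) ∧
    ∑ t, dens p (fun a => a.2.1) (x t) ≤ n * (h5 + δ) ∧
    ∑ t, dens p (fun a => a.1) (x t) ≤ n * (h6 + δ)
  have hT : ∀ x, x ∈ T ↔ (∀ t, 0 < p (x t)) ∧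
    ∑ t, dens p (fun a => (a.2.1, a.2.2)) (x t) ≤ n * (h1 + δ) ∧
    ∑ t, dens p (fun a => (a.1, a.2.2)) (x t) ≤ n * (h2 + δ) ∧
    ∑ t, dens p (fun a => (a.1, a.2.1)) (x t) ≤ n * (h3 + δ) ∧
    ∑ t, dens p (fun a => a.2.2) (x t) ≤ n * (h4 + δ) ∧
    ∑ t, dens p (fun a => a.2.1) (x t) ≤ n * (h5 + δ) ∧
    ∑ t, dens p (fun a => a.1) (x t) ≤ n * (h6 + δ) := by
      intro x; simp only [T, Finset.mem_filter, Finset.mem_univ, true_and]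
  clear_value T
  obtain ⟨F1, F2, F3, hF⟩ := binning T (iidW p n) (iid_pmf p hp n)
    (fun x t => (x t).1) (fun x t => (x t).2.1) (fun x t => (x t).2.2)
    (by
      intro x y e1 e2 e3
      funext t
      exact Prod.ext (congrFun e1 t) (Prod.ext (congrFun e2 t) (congrFun e3 t)))
    M1 M2 M3 q1 q2 q3
    ((2 : ℝ) ^ (n * (h1 + δ))) ((2 : ℝ) ^ (n * (h2 + δ))) ((2 : ℝ) ^ (n * (h3 + δ)))
    ((2 : ℝ) ^ (n * (h4 + δ))) ((2 : ℝ) ^ (n * (h5 + δ))) ((2 : ℝ) ^ (n * (h6 + δ)))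
    (by positivity) (by positivity) (by positivity) (by positivity) (by positivity) (by positivity)
    (by
      intro x hx
      refine count_bound p hp (fun a => (a.2.1, a.2.2)) n _ x ((hT x).1 hx).1 _ fun y hy => ?_
      replace hy := mem_filter_any hy
      exact ⟨((hT y).1 hy.1).1, ((hT y).1 hy.1).2.1, fun t =>
        Prod.ext (congrFun hy.2.1 t).symm (congrFun hy.2.2 t).symm⟩)
    (by
      intro x hx
      refine count_bound p hp (fun a => (a.1, a.2.2)) n _ x ((hT x).1 hx).1 _ fun y hy => ?_
      replace hy := mem_filter_any hy
      exact ⟨((hT y).1 hy.1).1, ((hT y).1 hy.1).2.2.1, fun t =>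
        Prod.ext (congrFun hy.2.1 t).symm (congrFun hy.2.2 t).symm⟩)
    (by
      intro x hx
      refine count_bound p hp (fun a => (a.1, a.2.1)) n _ x ((hT x).1 hx).1 _ fun y hy => ?_
      replace hy := mem_filter_any hy
      exact ⟨((hT y).1 hy.1).1, ((hT y).1 hy.1).2.2.2.1, fun t =>
        Prod.ext (congrFun hy.2.1 t).symm (congrFun hy.2.2 t).symm⟩)
    (by
      intro x hx
      refine count_bound p hp (fun a => a.2.2) n _ x ((hT x).1 hx).1 _ fun y hy => ?_
      replace hy := mem_filter_any hy
      exact ⟨((hT y).1 hy.1).1, ((hT y).1 hy.1).2.2.2.2.1, fun t => (congrFun hy.2 t).symm⟩)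
    (by
      intro x hx
      refine count_bound p hp (fun a => a.2.1) n _ x ((hT x).1 hx).1 _ fun y hy => ?_
      replace hy := mem_filter_any hy
      exact ⟨((hT y).1 hy.1).1, ((hT y).1 hy.1).2.2.2.2.2.1, fun t => (congrFun hy.2 t).symm⟩)
    (by
      intro x hx
      refine count_bound p hp (fun a => a.1) n _ x ((hT x).1 hx).1 _ fun y hy => ?_
      replace hy := mem_filter_any hy
      exact ⟨((hT y).1 hy.1).1, ((hT y).1 hy.1).2.2.2.2.2.2, fun t => (congrFun hy.2 t).symm⟩)
  refine ⟨F1, F2, F3, T, ?_⟩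
  have hTc : ∑ x ∈ Tᶜ, iidW p n x ≤ r1 ^ n + r2 ^ n + r3 ^ n + r4 ^ n + r5 ^ n + r6 ^ n := by
    refine le_trans ?_ (add_le_add (add_le_add (add_le_add (add_le_add (add_le_add g1 g2) g3) g4)
      g5) g6)
    simp only [← Finset.sum_add_distrib]
    rw [← Finset.sum_compl_add_sum T]
    have hite : ∀ (P : Prop) [Decidable P] (x : Fin n → X1 × X2 × X3),
        0 ≤ (if P then 0 else iidW p n x) := by
      intro P _ x
      split_ifs
      exacts [le_rfl, iid_nonneg p hp.1 n x]
    refine le_add_of_le_of_nonneg (Finset.sum_le_sum fun x hx => ?_) (Finset.sum_nonneg fun x _ => ?_)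
    · by_cases hw : iidW p n x = 0
      · rw [hw]; simp
      · have hpos := iid_pos p hp n x hw
        have hnn := iid_nonneg p hp.1 n x
        rw [Finset.mem_compl, hT] at hx
        have hx' := fun h => hx ⟨hpos, h⟩
        exact ite6 _ _ _ _ _ _ _ hnn hx'
    · have := fun (P : Prop) [Decidable P] => hite P x
      refine add_nonneg (add_nonneg (add_nonneg (add_nonneg (add_nonneg ?_ ?_) ?_) ?_) ?_) ?_ <;>
        apply this
  have v1 := term1 n h1 δ R1 _ k1 t1
  have v2 := term1 n h2 δ R2 _ k2 t2
  have v3 := term1 n h3 δ R3 _ k3 t3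
  have v4 := term2 n h4 δ R1 R2 _ _ hδ0.le k12 (by positivity) t1 t2
  have v5 := term2 n h5 δ R1 R3 _ _ hδ0.le k13 (by positivity) t1 t3
  have v6 := term2 n h6 δ R2 R3 _ _ hδ0.le k23 (by positivity) t2 t3
  linarith

end SW

/-- **Interactive lossless source coding.**  Every node must reconstruct both other
sources losslessly; a rate triple is achievable iff it satisfies the six Slepian–Wolf
type inequalities (so interaction does not enlarge the region). -/
theorem interactive_lossless_source_coding
    {X1 X2 X3 : Type} [Fintype X1] [Fintype X2] [Fintype X3]
    [Nonempty X1] [Nonempty X2] [Nonempty X3]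
    (p : X1 × X2 × X3 → ℝ) (hp : IsPMF p)
    (R1 R2 R3 : ℝ) :
    (∀ ε > (0 : ℝ), ∃ (n K : ℕ), 0 < n ∧ ∃ m1 m2 m3 : Fin K → ℕ,
      (∀ l, 0 < m1 l) ∧ (∀ l, 0 < m2 l) ∧ (∀ l, 0 < m3 l) ∧
      ∃ (J1 : (l : Fin K) → (Fin n → X1 × X2 × X3) → Fin (m1 l))
        (J2 : (l : Fin K) → (Fin n → X1 × X2 × X3) → Fin (m2 l))
        (J3 : (l : Fin K) → (Fin n → X1 × X2 × X3) → Fin (m3 l))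
        (g12 : (Fin n → X1) → ((l : Fin K) → Fin (m2 l)) → ((l : Fin K) → Fin (m3 l)) → Fin n → X2)
        (g13 : (Fin n → X1) → ((l : Fin K) → Fin (m2 l)) → ((l : Fin K) → Fin (m3 l)) → Fin n → X3)
        (g21 : (Fin n → X2) → ((l : Fin K) → Fin (m1 l)) → ((l : Fin K) → Fin (m3 l)) → Fin n → X1)
        (g23 : (Fin n → X2) → ((l : Fin K) → Fin (m1 l)) → ((l : Fin K) → Fin (m3 l)) → Fin n → X3)
        (g31 : (Fin n → X3) → ((l : Fin K) → Fin (m1 l)) → ((l : Fin K) → Fin (m2 l)) → Fin n → X1)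
        (g32 : (Fin n → X3) → ((l : Fin K) → Fin (m1 l)) → ((l : Fin K) → Fin (m2 l)) → Fin n → X2),
        -- encoder causality (canonical ordering 1 → 2 → 3 in each round)
        (∀ l : Fin K, ∃ f : (Fin n → X1) →
            ((k : Fin K) → k.val < l.val → Fin (m2 k)) →
            ((k : Fin K) → k.val < l.val → Fin (m3 k)) → Fin (m1 l),
          ∀ ω, J1 l ω = f (fun t => (ω t).1) (fun k _ => J2 k ω) (fun k _ => J3 k ω)) ∧
        (∀ l : Fin K, ∃ f : (Fin n → X2) →
            ((k : Fin K) → k.val ≤ l.val → Fin (m1 k)) →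
            ((k : Fin K) → k.val < l.val → Fin (m3 k)) → Fin (m2 l),
          ∀ ω, J2 l ω = f (fun t => (ω t).2.1) (fun k _ => J1 k ω) (fun k _ => J3 k ω)) ∧
        (∀ l : Fin K, ∃ f : (Fin n → X3) →
            ((k : Fin K) → k.val ≤ l.val → Fin (m1 k)) →
            ((k : Fin K) → k.val ≤ l.val → Fin (m2 k)) → Fin (m3 l),
          ∀ ω, J3 l ω = f (fun t => (ω t).2.2) (fun k _ => J1 k ω) (fun k _ => J2 k ω)) ∧
        -- rates
        (1 / (n : ℝ)) * ∑ l, Real.logb 2 (m1 l) ≤ R1 + ε ∧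
        (1 / (n : ℝ)) * ∑ l, Real.logb 2 (m2 l) ≤ R2 + ε ∧
        (1 / (n : ℝ)) * ∑ l, Real.logb 2 (m3 l) ≤ R3 + ε ∧
        -- all six lossless reconstruction constraints
        IT.pr (iidW p n) (fun ω =>
          (fun t => g12 (fun s => (ω s).1) (fun l => J2 l ω) (fun l => J3 l ω) t) ≠
            fun t => (ω t).2.1) ≤ ε ∧
        IT.pr (iidW p n) (fun ω =>
          (fun t => g13 (fun s => (ω s).1) (fun l => J2 l ω) (fun l => J3 l ω) t) ≠
            fun t => (ω t).2.2) ≤ ε ∧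
        IT.pr (iidW p n) (fun ω =>
          (fun t => g21 (fun s => (ω s).2.1) (fun l => J1 l ω) (fun l => J3 l ω) t) ≠
            fun t => (ω t).1) ≤ ε ∧
        IT.pr (iidW p n) (fun ω =>
          (fun t => g23 (fun s => (ω s).2.1) (fun l => J1 l ω) (fun l => J3 l ω) t) ≠
            fun t => (ω t).2.2) ≤ ε ∧
        IT.pr (iidW p n) (fun ω =>
          (fun t => g31 (fun s => (ω s).2.2) (fun l => J1 l ω) (fun l => J2 l ω) t) ≠
            fun t => (ω t).1) ≤ ε ∧
        IT.pr (iidW p n) (fun ω =>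
          (fun t => g32 (fun s => (ω s).2.2) (fun l => J1 l ω) (fun l => J2 l ω) t) ≠
            fun t => (ω t).2.1) ≤ ε)
    ↔
    (IT.condH p (fun a => a.1) (fun a => (a.2.1, a.2.2)) ≤ R1 ∧
     IT.condH p (fun a => a.2.1) (fun a => (a.1, a.2.2)) ≤ R2 ∧
     IT.condH p (fun a => a.2.2) (fun a => (a.1, a.2.1)) ≤ R3 ∧
     IT.condH p (fun a => (a.1, a.2.1)) (fun a => a.2.2) ≤ R1 + R2 ∧
     IT.condH p (fun a => (a.1, a.2.2)) (fun a => a.2.1) ≤ R1 + R3 ∧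
     IT.condH p (fun a => (a.2.1, a.2.2)) (fun a => a.1) ≤ R2 + R3) := by
  classical
  constructor
  · intro hach
    rw [SW.condH_eq p _ _ (by intro a b h; simp only [Prod.mk.injEq] at h; ext <;> simp [h]),
      SW.condH_eq p _ _ (by intro a b h; simp only [Prod.mk.injEq] at h; ext <;> simp [h]),
      SW.condH_eq p _ _ (by intro a b h; simp only [Prod.mk.injEq] at h; ext <;> simp [h]),
      SW.condH_eq p _ _ (by intro a b h; simp only [Prod.mk.injEq] at h; ext <;> simp [h]),
      SW.condH_eq p _ _ (by intro a b h; simp only [Prod.mk.injEq] at h; ext <;> simp [h]),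
      SW.condH_eq p _ _ (by intro a b h; simp only [Prod.mk.injEq] at h; ext <;> simp [h])]
    have rate : ∀ (n : ℕ) (r s : ℝ), 0 < n → (1 / (n : ℝ)) * r ≤ s → r ≤ n * s := by
      intro n r s hn h
      have hn0 : (0 : ℝ) < n := by exact_mod_cast hn
      rwa [one_div, inv_mul_le_iff₀ hn0] at h
    have ext3 : ∀ (n : ℕ) (x y : Fin n → X1 × X2 × X3), (∀ t, (x t).1 = (y t).1) →
        (∀ t, (x t).2.1 = (y t).2.1) → (∀ t, (x t).2.2 = (y t).2.2) → x = y := by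
      intro n x y h1 h2 h3
      funext t
      exact Prod.ext (h1 t) (Prod.ext (h2 t) (h3 t))
    refine ⟨?_, ?_, ?_, ?_, ?_, ?_⟩
    all_goals
      refine SW.conv_limit _ _ (Real.logb 2 (Fintype.card (X1 × X2 × X3))) fun ε hε hε1 => ?_
      obtain ⟨n, K, hn, m1, m2, m3, hm1, hm2, hm3, J1, J2, J3, g12, g13, g21, g23, g31, g32,
        c1, c2, c3, r1, r2, r3, e12, e13, e21, e23, e31, e32⟩ := hach ε hε
      have hw := SW.iid_nonneg p hp.1 n
      haveI : ∀ l, NeZero (m1 l) := fun l => ⟨(hm1 l).ne'⟩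
      haveI : ∀ l, NeZero (m2 l) := fun l => ⟨(hm2 l).ne'⟩
      haveI : ∀ l, NeZero (m3 l) := fun l => ⟨(hm3 l).ne'⟩
      replace r1 := rate n _ _ hn r1
      replace r2 := rate n _ _ hn r2
      replace r3 := rate n _ _ hn r3
      have hn0 : (0 : ℝ) ≤ n * ε := by positivity
      have L1 := SW.logb_card_pi m1 hm1
      have L2 := SW.logb_card_pi m2 hm2
      have L3 := SW.logb_card_pi m3 hm3
      have D := SW.det J1 J2 J3 c1 c2 c3
    · refine SW.conv_step p hp _ n hn _ (fun x l => J1 l x) ?_ R1 ε hε hε1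
        (by rw [L1]; linarith) (e21.trans (by linarith))
      intro x y hx hy hY hJ
      simp only [Prod.mk.injEq, not_not] at hx hy hY
      have hd := D x y (Or.inr (congrFun hJ)) (Or.inl fun t => (hY t).1) (Or.inl fun t => (hY t).2)
      refine ext3 n x y (fun t => ?_) (fun t => (hY t).1) (fun t => (hY t).2)
      rw [← congrFun hx t, ← congrFun hy t]
      simp only [(hY _).1, (hd _).1, (hd _).2.1, (hd _).2.2]
    · refine SW.conv_step p hp _ n hn _ (fun x l => J2 l x) ?_ R2 ε hε hε1
        (by rw [L2]; linarith) (e12.trans (by linarith))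
      intro x y hx hy hY hJ
      simp only [Prod.mk.injEq, not_not] at hx hy hY
      have hd := D x y (Or.inl fun t => (hY t).1) (Or.inr (congrFun hJ)) (Or.inl fun t => (hY t).2)
      refine ext3 n x y (fun t => (hY t).1) (fun t => ?_) (fun t => (hY t).2)
      rw [← congrFun hx t, ← congrFun hy t]
      simp only [(hY _).1, (hd _).1, (hd _).2.1, (hd _).2.2]
    · refine SW.conv_step p hp _ n hn _ (fun x l => J3 l x) ?_ R3 ε hε hε1
        (by rw [L3]; linarith) (e13.trans (by linarith))
      intro x y hx hy hY hJ
      simp only [Prod.mk.injEq, not_not] at hx hy hY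
      have hd := D x y (Or.inl fun t => (hY t).1) (Or.inl fun t => (hY t).2) (Or.inr (congrFun hJ))
      refine ext3 n x y (fun t => (hY t).1) (fun t => (hY t).2) (fun t => ?_)
      rw [← congrFun hx t, ← congrFun hy t]
      simp only [(hY _).1, (hd _).1, (hd _).2.1, (hd _).2.2]
    · refine SW.conv_step p hp _ n hn _ (fun x => (fun l => J1 l x, fun l => J2 l x)) ?_ (R1 + R2)
        ε hε hε1 ?_ ((SW.pr_or _ hw _ _).trans ((add_le_add e31 e32).trans (by linarith)))
      · intro x y hx hy hY hJ
        simp only [Prod.mk.injEq, not_or, not_not] at hx hy hY hJ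
        have hd := D x y (Or.inr (congrFun hJ.1)) (Or.inr (congrFun hJ.2)) (Or.inl hY)
        refine ext3 n x y (fun t => ?_) (fun t => ?_) hY
        · rw [← congrFun hx.1 t, ← congrFun hy.1 t]
          simp only [hY, (hd _).1, (hd _).2.1, (hd _).2.2]
        · rw [← congrFun hx.2 t, ← congrFun hy.2 t]
          simp only [hY, (hd _).1, (hd _).2.1, (hd _).2.2]
      · rw [Fintype.card_prod, Nat.cast_mul, Real.logb_mul (Nat.cast_ne_zero.2 Fintype.card_ne_zero)
          (Nat.cast_ne_zero.2 Fintype.card_ne_zero), L1, L2]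
        linarith
    · refine SW.conv_step p hp _ n hn _ (fun x => (fun l => J1 l x, fun l => J3 l x)) ?_ (R1 + R3)
        ε hε hε1 ?_ ((SW.pr_or _ hw _ _).trans ((add_le_add e21 e23).trans (by linarith)))
      · intro x y hx hy hY hJ
        simp only [Prod.mk.injEq, not_or, not_not] at hx hy hY hJ
        have hd := D x y (Or.inr (congrFun hJ.1)) (Or.inl hY) (Or.inr (congrFun hJ.2))
        refine ext3 n x y (fun t => ?_) hY (fun t => ?_)
        · rw [← congrFun hx.1 t, ← congrFun hy.1 t]
          simp only [hY, (hd _).1, (hd _).2.1, (hd _).2.2]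
        · rw [← congrFun hx.2 t, ← congrFun hy.2 t]
          simp only [hY, (hd _).1, (hd _).2.1, (hd _).2.2]
      · rw [Fintype.card_prod, Nat.cast_mul, Real.logb_mul (Nat.cast_ne_zero.2 Fintype.card_ne_zero)
          (Nat.cast_ne_zero.2 Fintype.card_ne_zero), L1, L3]
        linarith
    · refine SW.conv_step p hp _ n hn _ (fun x => (fun l => J2 l x, fun l => J3 l x)) ?_ (R2 + R3)
        ε hε hε1 ?_ ((SW.pr_or _ hw _ _).trans ((add_le_add e12 e13).trans (by linarith)))
      · intro x y hx hy hY hJ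
        simp only [Prod.mk.injEq, not_or, not_not] at hx hy hY hJ
        have hd := D x y (Or.inl hY) (Or.inr (congrFun hJ.1)) (Or.inr (congrFun hJ.2))
        refine ext3 n x y hY (fun t => ?_) (fun t => ?_)
        · rw [← congrFun hx.1 t, ← congrFun hy.1 t]
          simp only [hY, (hd _).1, (hd _).2.1, (hd _).2.2]
        · rw [← congrFun hx.2 t, ← congrFun hy.2 t]
          simp only [hY, (hd _).1, (hd _).2.1, (hd _).2.2]
      · rw [Fintype.card_prod, Nat.cast_mul, Real.logb_mul (Nat.cast_ne_zero.2 Fintype.card_ne_zero)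
          (Nat.cast_ne_zero.2 Fintype.card_ne_zero), L2, L3]
        linarith
  · rw [SW.condH_eq p _ _ (by intro a b h; simp only [Prod.mk.injEq] at h; ext <;> simp [h]),
      SW.condH_eq p _ _ (by intro a b h; simp only [Prod.mk.injEq] at h; ext <;> simp [h]),
      SW.condH_eq p _ _ (by intro a b h; simp only [Prod.mk.injEq] at h; ext <;> simp [h]),
      SW.condH_eq p _ _ (by intro a b h; simp only [Prod.mk.injEq] at h; ext <;> simp [h]),
      SW.condH_eq p _ _ (by intro a b h; simp only [Prod.mk.injEq] at h; ext <;> simp [h]),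
      SW.condH_eq p _ _ (by intro a b h; simp only [Prod.mk.injEq] at h; ext <;> simp [h])]
    rintro ⟨k1, k2, k3, k12, k13, k23⟩ ε hε
    obtain ⟨n, M1, M2, M3, hn, q1, q2, q3, s1, s2, s3, F1, F2, F3, T, hT⟩ :=
      SW.ach p hp R1 R2 R3 k1 k2 k3 k12 k13 k23 ε hε
    have hw := SW.iid_nonneg p hp.1 n
    -- the estimates found by the three decoders
    let dec1 : (Fin n → X1) → Fin M2 → Fin M3 → (Fin n → X1 × X2 × X3) := fun x b c =>
      Classical.epsilon fun y => y ∈ T ∧ (fun t => (y t).1) = x ∧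
        F2 (fun t => (y t).2.1) = b ∧ F3 (fun t => (y t).2.2) = c
    let dec2 : (Fin n → X2) → Fin M1 → Fin M3 → (Fin n → X1 × X2 × X3) := fun x b c =>
      Classical.epsilon fun y => y ∈ T ∧ (fun t => (y t).2.1) = x ∧
        F1 (fun t => (y t).1) = b ∧ F3 (fun t => (y t).2.2) = c
    let dec3 : (Fin n → X3) → Fin M1 → Fin M2 → (Fin n → X1 × X2 × X3) := fun x b c =>
      Classical.epsilon fun y => y ∈ T ∧ (fun t => (y t).2.2) = x ∧
        F1 (fun t => (y t).1) = b ∧ F2 (fun t => (y t).2.1) = c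
    have hnc : ∀ x, SW.coll T (fun x t => (x t).1) (fun x t => (x t).2.1) (fun x t => (x t).2.2)
        F1 F2 F3 x = ∅ → ∀ y ∈ T, ((fun t => (x t).1) = (fun t => (y t).1) ∨
          (fun t => (x t).2.1) = (fun t => (y t).2.1) ∨ (fun t => (x t).2.2) = fun t => (y t).2.2) →
        F1 (fun t => (x t).1) = F1 (fun t => (y t).1) →
        F2 (fun t => (x t).2.1) = F2 (fun t => (y t).2.1) →
        F3 (fun t => (x t).2.2) = F3 (fun t => (y t).2.2) → y = x := by
      intro x hx y hy ho f1 f2 f3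
      by_contra hne
      have : y ∈ SW.coll T (fun x t => (x t).1) (fun x t => (x t).2.1) (fun x t => (x t).2.2)
        F1 F2 F3 x := by
        unfold SW.coll
        simp only [Finset.mem_filter]
        exact ⟨hy, ⟨hne, ho⟩, f1, f2, f3⟩
      rw [hx] at this
      simp at this
    have hd1 : ∀ x ∈ T, SW.coll T (fun x t => (x t).1) (fun x t => (x t).2.1)
        (fun x t => (x t).2.2) F1 F2 F3 x = ∅ →
        dec1 (fun t => (x t).1) (F2 fun t => (x t).2.1) (F3 fun t => (x t).2.2) = x := by
      intro x hx hc
      have hs := Classical.epsilon_spec (p := fun y => y ∈ T ∧ (fun t => (y t).1) = (fun t => (x t).1) ∧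
        F2 (fun t => (y t).2.1) = F2 (fun t => (x t).2.1) ∧
        F3 (fun t => (y t).2.2) = F3 (fun t => (x t).2.2)) ⟨x, hx, rfl, rfl, rfl⟩
      exact hnc x hc _ hs.1 (Or.inl hs.2.1.symm) (congrArg F1 hs.2.1.symm) hs.2.2.1.symm
        hs.2.2.2.symm
    have hd2 : ∀ x ∈ T, SW.coll T (fun x t => (x t).1) (fun x t => (x t).2.1)
        (fun x t => (x t).2.2) F1 F2 F3 x = ∅ →
        dec2 (fun t => (x t).2.1) (F1 fun t => (x t).1) (F3 fun t => (x t).2.2) = x := by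
      intro x hx hc
      have hs := Classical.epsilon_spec (p := fun y => y ∈ T ∧
        (fun t => (y t).2.1) = (fun t => (x t).2.1) ∧
        F1 (fun t => (y t).1) = F1 (fun t => (x t).1) ∧
        F3 (fun t => (y t).2.2) = F3 (fun t => (x t).2.2)) ⟨x, hx, rfl, rfl, rfl⟩
      exact hnc x hc _ hs.1 (Or.inr (Or.inl hs.2.1.symm)) hs.2.2.1.symm
        (congrArg F2 hs.2.1.symm) hs.2.2.2.symm
    have hd3 : ∀ x ∈ T, SW.coll T (fun x t => (x t).1) (fun x t => (x t).2.1)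
        (fun x t => (x t).2.2) F1 F2 F3 x = ∅ →
        dec3 (fun t => (x t).2.2) (F1 fun t => (x t).1) (F2 fun t => (x t).2.1) = x := by
      intro x hx hc
      have hs := Classical.epsilon_spec (p := fun y => y ∈ T ∧
        (fun t => (y t).2.2) = (fun t => (x t).2.2) ∧
        F1 (fun t => (y t).1) = F1 (fun t => (x t).1) ∧
        F2 (fun t => (y t).2.1) = F2 (fun t => (x t).2.1)) ⟨x, hx, rfl, rfl, rfl⟩
      exact hnc x hc _ hs.1 (Or.inr (Or.inr hs.2.1.symm)) hs.2.2.1.symm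
        hs.2.2.2.symm (congrArg F3 hs.2.1.symm)
    clear_value dec1 dec2 dec3
    refine ⟨n, 1, hn, fun _ => M1, fun _ => M2, fun _ => M3, fun _ => q1, fun _ => q2, fun _ => q3,
      fun _ x => F1 fun t => (x t).1, fun _ x => F2 fun t => (x t).2.1,
      fun _ x => F3 fun t => (x t).2.2,
      fun x b c t => (dec1 x (b 0) (c 0) t).2.1, fun x b c t => (dec1 x (b 0) (c 0) t).2.2,
      fun x b c t => (dec2 x (b 0) (c 0) t).1, fun x b c t => (dec2 x (b 0) (c 0) t).2.2,
      fun x b c t => (dec3 x (b 0) (c 0) t).1, fun x b c t => (dec3 x (b 0) (c 0) t).2.1,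
      fun _ => ⟨fun x _ _ => F1 x, fun _ => rfl⟩, fun _ => ⟨fun x _ _ => F2 x, fun _ => rfl⟩,
      fun _ => ⟨fun x _ _ => F3 x, fun _ => rfl⟩, by simpa using s1, by simpa using s2,
      by simpa using s3, ?_, ?_, ?_, ?_, ?_, ?_⟩
    · refine (SW.pr_le _ hw T (SW.coll T (fun x t => (x t).1) (fun x t => (x t).2.1)
        (fun x t => (x t).2.2) F1 F2 F3) _ fun x hx hc => ?_).trans hT
      simp only [hd1 x hx hc, ne_eq, not_true_eq_false, not_false_eq_true]
    · refine (SW.pr_le _ hw T (SW.coll T (fun x t => (x t).1) (fun x t => (x t).2.1)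
        (fun x t => (x t).2.2) F1 F2 F3) _ fun x hx hc => ?_).trans hT
      simp only [hd1 x hx hc, ne_eq, not_true_eq_false, not_false_eq_true]
    · refine (SW.pr_le _ hw T (SW.coll T (fun x t => (x t).1) (fun x t => (x t).2.1)
        (fun x t => (x t).2.2) F1 F2 F3) _ fun x hx hc => ?_).trans hT
      simp only [hd2 x hx hc, ne_eq, not_true_eq_false, not_false_eq_true]
    · refine (SW.pr_le _ hw T (SW.coll T (fun x t => (x t).1) (fun x t => (x t).2.1)
        (fun x t => (x t).2.2) F1 F2 F3) _ fun x hx hc => ?_).trans hT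
      simp only [hd2 x hx hc, ne_eq, not_true_eq_false, not_false_eq_true]
    · refine (SW.pr_le _ hw T (SW.coll T (fun x t => (x t).1) (fun x t => (x t).2.1)
        (fun x t => (x t).2.2) F1 F2 F3) _ fun x hx hc => ?_).trans hT
      simp only [hd3 x hx hc, ne_eq, not_true_eq_false, not_false_eq_true]
    · refine (SW.pr_le _ hw T (SW.coll T (fun x t => (x t).1) (fun x t => (x t).2.1)
        (fun x t => (x t).2.2) F1 F2 F3) _ fun x hx hc => ?_).trans hT
      simp only [hd3 x hx hc, ne_eq, not_true_eq_false, not_false_eq_true]
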